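/- arXiv:1910.11217 — 7 statements merged into one kernel-verified Lean document; each statement's English description precedes it below -/
import Mathlib

section
/- Let L > 0 and let f : ℝ^N → ℝ be differentiable and L-smooth, let h : ℝ^N → ℝ be any function, and set H = f + h. Fix x ∈ ℝ^N and a vector g̃ ∈ ℝ^N. Suppose y ∈ ℝ^N minimizes over ℝ^N the function Q(y') = ⟨g̃, y' − x⟩ + (3L/2)‖y' − x‖² + h(y') − h(x), and set Prog(x) = −Q(y). Then Prog(x) ≥ 0 and H(x) − H(y) ≥ Prog(x) − (1/(4L))‖g̃ − ∇f(x)‖². -/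
open scoped RealInnerProductSpace

/-- The quadratic upper bound for a function with Lipschitz gradient. -/
theorem le_add_inner_gradient_add_sq {E : Type*} [NormedAddCommGroup E] [InnerProductSpace ℝ E]
    [CompleteSpace E] {f : E → ℝ} {L : ℝ} (hf : Differentiable ℝ f)
    (hsmooth : ∀ x y : E, ‖gradient f x - gradient f y‖ ≤ L * ‖x - y‖) (x y : E) :
    f y ≤ f x + ⟪gradient f x, y - x⟫ + L / 2 * ‖y - x‖ ^ 2 := by
  set d := y - x with hd
  let φ : ℝ → ℝ := fun t => f (x + t • d) - t * ⟪gradient f x, d⟫ - t ^ 2 * (L / 2 * ‖d‖ ^ 2)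
  have hφ (t : ℝ) : HasDerivAt φ
      (⟪gradient f (x + t • d), d⟫ - ⟪gradient f x, d⟫ - t * (L * ‖d‖ ^ 2)) t := by
    have hline : HasDerivAt (fun s : ℝ => x + s • d) d t := by
      simpa using ((hasDerivAt_id t).smul_const d).const_add x
    have hcomp : HasDerivAt (fun s : ℝ => f (x + s • d)) ⟪gradient f (x + t • d), d⟫ t := by
      have hgrad := (hf (x + t • d)).hasGradientAt.hasFDerivAt
      exact hgrad.comp_hasDerivAt t hline
    refine ((hcomp.sub ((hasDerivAt_id t).mul_const ⟪gradient f x, d⟫)).sub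
      ((hasDerivAt_pow 2 t).mul_const (L / 2 * ‖d‖ ^ 2))).congr_deriv ?_
    norm_num
    ring
  have hanti : AntitoneOn φ (Set.Icc 0 1) := by
    refine antitoneOn_of_deriv_nonpos (convex_Icc 0 1)
      (fun t _ => (hφ t).continuousAt.continuousWithinAt)
      (fun t _ => (hφ t).differentiableAt.differentiableWithinAt) fun t ht => ?_
    rw [interior_Icc] at ht
    rw [(hφ t).deriv, ← inner_sub_left, sub_nonpos]
    calc ⟪gradient f (x + t • d) - gradient f x, d⟫
        ≤ ‖gradient f (x + t • d) - gradient f x‖ * ‖d‖ := real_inner_le_norm _ _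
      _ ≤ L * ‖x + t • d - x‖ * ‖d‖ := by gcongr; exact hsmooth _ _
      _ = t * (L * ‖d‖ ^ 2) := by
        rw [add_sub_cancel_left, norm_smul, Real.norm_of_nonneg ht.1.le]
        ring
  have h01 := hanti (Set.left_mem_Icc.2 zero_le_one) (Set.right_mem_Icc.2 zero_le_one) zero_le_one
  simp only [φ, hd, one_smul, zero_smul, add_zero, add_sub_cancel] at h01
  linarith

/-- Young's inequality for the inner product, in lower bound form. -/
theorem neg_sq_norm_le_inner_add_sq {E : Type*} [NormedAddCommGroup E] [InnerProductSpace ℝ E]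
    {L : ℝ} (hL : 0 < L) (u d : E) :
    -(1 / (4 * L) * ‖u‖ ^ 2) ≤ ⟪u, d⟫ + L * ‖d‖ ^ 2 := by
  have hsq : ‖u + (2 * L) • d‖ ^ 2 = ‖u‖ ^ 2 + 4 * L * (⟪u, d⟫ + L * ‖d‖ ^ 2) := by
    rw [norm_add_sq_real, inner_smul_right, norm_smul, mul_pow, Real.norm_eq_abs, sq_abs]
    ring
  rw [one_div_mul_eq_div, neg_le, le_div_iff₀ (by positivity)]
  linarith [sq_nonneg ‖u + (2 * L) • d‖]

/-- progress of the gradient descent step (Lemma 3.1 / Lemma 2.3 of Katyusha). -/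
theorem gradient_descent_step_progress
    (N : ℕ) (L : ℝ) (hL : 0 < L)
    (f h : EuclideanSpace ℝ (Fin N) → ℝ)
    (hf : Differentiable ℝ f)
    (hsmooth : ∀ x y : EuclideanSpace ℝ (Fin N),
      ‖gradient f x - gradient f y‖ ≤ L * ‖x - y‖)
    (H : EuclideanSpace ℝ (Fin N) → ℝ) (hH : H = fun z => f z + h z)
    (x gt y : EuclideanSpace ℝ (Fin N))
    (Q : EuclideanSpace ℝ (Fin N) → ℝ)
    (hQ : Q = fun y' => ⟪gt, y' - x⟫ + 3 * L / 2 * ‖y' - x‖ ^ 2 + h y' - h x)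
    (hy : ∀ y', Q y ≤ Q y') :
    0 ≤ -Q y ∧ H x - H y ≥ -Q y - 1 / (4 * L) * ‖gt - gradient f x‖ ^ 2 := by
  subst hH hQ
  constructor
  · simpa using hy x
  · have hdescent := le_add_inner_gradient_add_sq hf hsmooth x y
    have hyoung := neg_sq_norm_le_inner_add_sq hL (gt - gradient f x) (y - x)
    rw [inner_sub_left] at hyoung
    dsimp only
    linarith
end

section
/- Let h : ℝ^N → ℝ be μ-strongly convex with μ > 0, let α > 0, and let g̃, z₀ ∈ ℝ^N. If z⁺ minimizes over ℝ^N the function z ↦ α⟨g̃, z − z₀⟩ + (1/2)‖z − z₀‖² + α h(z) − α h(z₀), then for every u ∈ ℝ^N: α⟨g̃, z⁺ − u⟩ + α h(z⁺) − α h(u) ≤ −(1/2)‖z₀ − z⁺‖² + (1/2)‖z₀ − u‖² − ((1 + αμ)/2)‖z⁺ − u‖². -/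
open scoped RealInnerProductSpace

open Set Filter Topology in
/-- A strongly convex function grows at least quadratically away from a minimizer. -/
theorem StrongConvexOn.add_norm_sub_sq_le_of_isMinOn {E : Type*} [NormedAddCommGroup E]
    [NormedSpace ℝ E] {s : Set E} {m : ℝ} {f : E → ℝ} (hf : StrongConvexOn s m f)
    {x u : E} (hx : x ∈ s) (hmin : IsMinOn f s x) (hu : u ∈ s) :
    f x + m / 2 * ‖x - u‖ ^ 2 ≤ f u := by
  have key : ∀ a ∈ Ioo (0 : ℝ) 1, f x + (1 - a) * (m / 2 * ‖x - u‖ ^ 2) ≤ f u := by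
    intro a ha
    have hb : 0 ≤ 1 - a := by linarith [ha.2]
    have hab : a + (1 - a) = 1 := by ring
    have h₁ := hf.2 hu hx ha.1.le hb hab
    have h₂ := isMinOn_iff.1 hmin _ (hf.1 hu hx ha.1.le hb hab)
    rw [norm_sub_rev u x] at h₁
    simp only [smul_eq_mul] at h₁
    refine le_of_mul_le_mul_left ?_ ha.1
    linarith
  have hlim : Tendsto (fun a : ℝ => f x + (1 - a) * (m / 2 * ‖x - u‖ ^ 2)) (𝓝[>] 0)
      (𝓝 (f x + (1 - 0) * (m / 2 * ‖x - u‖ ^ 2))) :=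
    tendsto_nhdsWithin_of_tendsto_nhds (Continuous.tendsto (by fun_prop) 0)
  have := le_of_tendsto hlim (eventually_of_mem (Ioo_mem_nhdsGT one_pos) key)
  simpa using this

/-- Adding a linear term and half the squared distance to a point to a nonnegative multiple of
a strongly convex function gives a strongly convex function. -/
theorem StrongConvexOn.proximal_objective {E : Type*} [NormedAddCommGroup E]
    [InnerProductSpace ℝ E] {s : Set E} {m a : ℝ} {f : E → ℝ} (hf : StrongConvexOn s m f)
    (ha : 0 ≤ a) (v w : E) :
    StrongConvexOn s (1 + a * m) (fun z => ⟪v, z⟫ + 1 / 2 * ‖z - w‖ ^ 2 + a * f z) := by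
  rw [strongConvexOn_iff_convex] at hf ⊢
  have hlin : ConvexOn ℝ s fun z => ⟪v - w, z⟫ :=
    (innerSL ℝ (v - w)).toLinearMap.convexOn hf.1
  refine (((hf.smul ha).add hlin).add_const (1 / 2 * ‖w‖ ^ 2)).congr fun z _ => ?_
  simp only [Pi.add_apply, smul_eq_mul, inner_sub_left, norm_sub_sq_real, real_inner_comm w z]
  ring

/-- progress of the mirror descent step (Lemma 3.3 / Lemma 2.5 of Katyusha). -/
theorem mirror_descent_step_progress
    (N : ℕ) (μ α : ℝ) (hμ : 0 < μ) (hα : 0 < α)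
    (h : EuclideanSpace ℝ (Fin N) → ℝ)
    (hconv : ConvexOn ℝ Set.univ (fun x => h x - μ / 2 * ‖x‖ ^ 2))
    (gt z₀ zp : EuclideanSpace ℝ (Fin N))
    (hzp : ∀ z : EuclideanSpace ℝ (Fin N),
      α * ⟪gt, zp - z₀⟫ + 1 / 2 * ‖zp - z₀‖ ^ 2 + α * h zp - α * h z₀
        ≤ α * ⟪gt, z - z₀⟫ + 1 / 2 * ‖z - z₀‖ ^ 2 + α * h z - α * h z₀) :
    ∀ u : EuclideanSpace ℝ (Fin N),
      α * ⟪gt, zp - u⟫ + α * h zp - α * h u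
        ≤ -(1 / 2) * ‖z₀ - zp‖ ^ 2 + 1 / 2 * ‖z₀ - u‖ ^ 2
          - (1 + α * μ) / 2 * ‖zp - u‖ ^ 2 := by
  intro u
  have hF := (strongConvexOn_iff_convex.2 hconv).proximal_objective hα.le (α • gt) z₀
  have hmin : IsMinOn (fun z => ⟪α • gt, z⟫ + 1 / 2 * ‖z - z₀‖ ^ 2 + α * h z) Set.univ zp := by
    refine isMinOn_iff.2 fun z _ => ?_
    have := hzp z
    simp only [inner_sub_right, real_inner_smul_left] at this ⊢
    linarith
  have hgrowth := hF.add_norm_sub_sq_le_of_isMinOn (Set.mem_univ zp) hmin (Set.mem_univ u)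
  simp only [real_inner_smul_left] at hgrowth
  rw [inner_sub_right, norm_sub_rev z₀ zp, norm_sub_rev z₀ u]
  linarith
end

section
/- Let G_1,…,G_{n2} : ℝ^{N2} → ℝ^{N1} be differentiable, each L_G-smooth and with B_G-bounded Jacobian, let G = (1/n2) Σ_j G_j, and let g : ℝ^{N1} → ℝ be differentiable, l-smooth and with b-bounded gradient. Fix x, x̃ ∈ ℝ^{N2} and integers A, B ≥ 1. For maps σ : {1,…,A} → {1,…,n2} and τ : {1,…,B} → {1,…,n2}, define Ĝ(σ) = (1/A) Σ_{t=1}^{A} (G_{σ(t)}(x) − G_{σ(t)}(x̃)) + G(x̃) and ∇Ĝ(τ) = (1/B) Σ_{t=1}^{B} (∇G_{τ(t)}(x) − ∇G_{τ(t)}(x̃)) + ∇G(x̃). Then the average over all pairs (σ, τ), namely n2^{−A} n2^{−B} Σ_{σ,τ} ‖[∇Ĝ(τ)]ᵀ ∇g(Ĝ(σ)) − [∇G(x)]ᵀ ∇g(G(x))‖², is at most (2 B_G⁴ l² / A + 2 b² L_G² / B) ‖x̃ − x‖². -/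
open Matrix

/-- The Frobenius norm of a real matrix. -/
noncomputable def frobNorm {k l : Type*} [Fintype k] [Fintype l] (M : Matrix k l ℝ) : ℝ :=
  Real.sqrt (∑ i, ∑ j, (M i j) ^ 2)

open Finset in
/-- The sum over all index maps of the squared norm of a sum of centred vectors. -/
theorem sum_norm_sq_sum_of_sum_eq_zero {E : Type*} [NormedAddCommGroup E] [InnerProductSpace ℝ E]
    {n : ℕ} (w : Fin n → E) (hw : ∑ j, w j = 0) (A : ℕ) :
    (n : ℝ) * ∑ σ : Fin A → Fin n, ‖∑ t, w (σ t)‖ ^ 2 = A * (n : ℝ) ^ A * ∑ j, ‖w j‖ ^ 2 := by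
  induction A with
  | zero => simp
  | succ A ih =>
    have split : ∑ σ : Fin (A + 1) → Fin n, ‖∑ t, w (σ t)‖ ^ 2
        = ∑ j, ∑ σ : Fin A → Fin n, ‖w j + ∑ t, w (σ t)‖ ^ 2 := by
      rw [← Fintype.sum_prod_type', ← (Fin.consEquiv fun _ => Fin n).sum_comp]
      simp [Fin.consEquiv, Fin.sum_univ_succ]
    have cross : ∑ j, ∑ σ : Fin A → Fin n, inner ℝ (w j) (∑ t, w (σ t)) = 0 := by
      rw [sum_comm]
      simp [← sum_inner, hw]
    simp only [split, norm_add_sq_real, sum_add_distrib, ← mul_sum, cross]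
    simp only [sum_const, card_univ, Fintype.card_pi, Fintype.card_fin, prod_const, nsmul_eq_mul,
      ← mul_sum, Nat.cast_pow]
    push_cast
    linear_combination (n : ℝ) * ih

/-- Averaging `A` independent uniform samples divides the second moment of the error by `A`. -/
theorem average_norm_sq_sample_mean_sub_le {E : Type*} [NormedAddCommGroup E]
    [InnerProductSpace ℝ E] {n : ℕ} (hn : 0 < n) (v : Fin n → E) {A : ℕ} (hA : 1 ≤ A)
    {c : ℝ} (hv : ∀ j, ‖v j‖ ^ 2 ≤ c) :
    ((n : ℝ) ^ A)⁻¹ * ∑ σ : Fin A → Fin n,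
      ‖(A : ℝ)⁻¹ • ∑ t, v (σ t) - (n : ℝ)⁻¹ • ∑ j, v j‖ ^ 2 ≤ c / A := by
  have hn' : (0 : ℝ) < n := by exact_mod_cast hn
  have hA' : (0 : ℝ) < A := by exact_mod_cast hA
  set m := (n : ℝ)⁻¹ • ∑ j, v j with hm
  have hsum : ∑ j, v j = (n : ℝ) • m := by rw [hm, smul_inv_smul₀ hn'.ne']
  have centred : ∑ j, (v j - m) = 0 := by
    simp [Finset.sum_sub_distrib, hsum, Nat.cast_smul_eq_nsmul]
  have error (σ : Fin A → Fin n) : ‖(A : ℝ)⁻¹ • ∑ t, v (σ t) - m‖ ^ 2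
      = ((A : ℝ)⁻¹) ^ 2 * ‖∑ t, (v (σ t) - m)‖ ^ 2 := by
    rw [← mul_pow, ← Real.norm_of_nonneg (inv_nonneg.2 hA'.le), ← norm_smul,
      Real.norm_of_nonneg (inv_nonneg.2 hA'.le)]
    congr 2
    rw [Finset.sum_sub_distrib, smul_sub]
    simp [← Nat.cast_smul_eq_nsmul ℝ, smul_smul, hA'.ne']
  have second_moment : ∑ j, ‖v j - m‖ ^ 2 ≤ n * c := by
    have expand : ∑ j, ‖v j - m‖ ^ 2 = ∑ j, ‖v j‖ ^ 2 - n * ‖m‖ ^ 2 := by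
      simp only [norm_sub_sq_real, Finset.sum_add_distrib, Finset.sum_sub_distrib,
        ← Finset.mul_sum, ← sum_inner, hsum, inner_smul_left, real_inner_self_eq_norm_sq]
      simp
      ring
    have bound : ∑ j, ‖v j‖ ^ 2 ≤ n * c := by
      simpa using Finset.sum_le_sum fun j (_ : j ∈ Finset.univ) => hv j
    have : 0 ≤ n * ‖m‖ ^ 2 := by positivity
    linarith
  have total := sum_norm_sq_sum_of_sum_eq_zero _ centred A
  have total' : ∑ σ : Fin A → Fin n, ‖∑ t, (v (σ t) - m)‖ ^ 2
      = A * (n : ℝ) ^ A * (∑ j, ‖v j - m‖ ^ 2) / n := by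
    rw [← total]; field_simp
  simp only [error, ← Finset.mul_sum, total']
  calc _ = (∑ j, ‖v j - m‖ ^ 2) / (n * A) := by field_simp
    _ ≤ n * c / (n * A) := by gcongr
    _ = c / A := by field_simp

/-- The entries of a matrix as a Euclidean vector, a Frobenius isometry. -/
noncomputable def euclideanVec (k l : Type*) :
    Matrix k l ℝ →ₗ[ℝ] EuclideanSpace ℝ (k × l) where
  toFun M := WithLp.toLp 2 fun p => M p.1 p.2
  map_add' _ _ := rfl
  map_smul' _ _ := rfl

section frobNorm

variable {k l : Type*} [Fintype k] [Fintype l]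

theorem norm_euclideanVec (M : Matrix k l ℝ) : ‖euclideanVec k l M‖ = frobNorm M := by
  simp [EuclideanSpace.norm_eq, frobNorm, euclideanVec, Fintype.sum_prod_type]
  rfl

theorem frobNorm_nonneg (M : Matrix k l ℝ) : 0 ≤ frobNorm M := Real.sqrt_nonneg _

theorem frobNorm_transpose (M : Matrix k l ℝ) : frobNorm Mᵀ = frobNorm M := by
  rw [frobNorm, frobNorm, Finset.sum_comm]
  rfl

theorem norm_toEuclideanLin_le [DecidableEq l] (M : Matrix k l ℝ) (y : EuclideanSpace ℝ l) :
    ‖Matrix.toEuclideanLin M y‖ ≤ frobNorm M * ‖y‖ := by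
  rw [EuclideanSpace.norm_eq, EuclideanSpace.norm_eq, frobNorm, ← Real.sqrt_mul (by positivity),
    Finset.sum_mul]
  refine Real.sqrt_le_sqrt (Finset.sum_le_sum fun i _ => ?_)
  simpa [Matrix.toEuclideanLin, Matrix.mulVec, dotProduct] using
    Finset.sum_mul_sq_le_sq_mul_sq Finset.univ (M i) y

end frobNorm

/-- The mean value inequality for maps with Jacobian bounded in Frobenius norm. -/
theorem norm_sub_le_of_frobNorm_le {k l : Type*} [Fintype k] [Fintype l] [DecidableEq l]
    {F : EuclideanSpace ℝ l → EuclideanSpace ℝ k} {DF : EuclideanSpace ℝ l → Matrix k l ℝ} {C : ℝ}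
    (hF : ∀ x, HasFDerivAt F ((Matrix.toEuclideanLin (DF x)).toContinuousLinearMap) x)
    (hDF : ∀ x, frobNorm (DF x) ≤ C) (x y : EuclideanSpace ℝ l) :
    ‖F x - F y‖ ≤ C * ‖x - y‖ := by
  refine convex_univ.norm_image_sub_le_of_norm_hasFDerivWithin_le
    (fun z _ => (hF z).hasFDerivWithinAt) (fun z _ => ?_) (Set.mem_univ y) (Set.mem_univ x)
  refine ContinuousLinearMap.opNorm_le_bound _ ((frobNorm_nonneg _).trans (hDF z)) fun v => ?_
  exact (norm_toEuclideanLin_le _ v).trans (by gcongr; exact hDF z)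

/-- The perturbation of a transposed matrix-vector product. -/
theorem norm_sq_toEuclideanLin_transpose_sub_le {k l : Type*} [Fintype k] [Fintype l]
    [DecidableEq k] (M M' : Matrix k l ℝ) (u u' : EuclideanSpace ℝ k) {C b d : ℝ}
    (hM' : frobNorm M' ≤ C) (hu : ‖u‖ ≤ b) (hd : ‖u - u'‖ ≤ d) :
    ‖Matrix.toEuclideanLin Mᵀ u - Matrix.toEuclideanLin M'ᵀ u'‖ ^ 2
      ≤ 2 * b ^ 2 * frobNorm (M - M') ^ 2 + 2 * C ^ 2 * d ^ 2 := by
  have split : Matrix.toEuclideanLin Mᵀ u - Matrix.toEuclideanLin M'ᵀ u'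
      = Matrix.toEuclideanLin (M - M')ᵀ u + Matrix.toEuclideanLin M'ᵀ (u - u') := by
    simp [Matrix.transpose_sub]
  have h₁ : ‖Matrix.toEuclideanLin (M - M')ᵀ u‖ ≤ frobNorm (M - M') * b := by
    refine (norm_toEuclideanLin_le _ _).trans ?_
    rw [frobNorm_transpose]
    exact mul_le_mul_of_nonneg_left hu (frobNorm_nonneg _)
  have h₂ : ‖Matrix.toEuclideanLin M'ᵀ (u - u')‖ ≤ C * d := by
    refine (norm_toEuclideanLin_le _ _).trans ?_
    rw [frobNorm_transpose]
    exact mul_le_mul hM' hd (norm_nonneg _) ((frobNorm_nonneg _).trans hM')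
  calc _ ≤ (frobNorm (M - M') * b + C * d) ^ 2 := by
        rw [split]
        gcongr
        exact (norm_add_le _ _).trans (add_le_add h₁ h₂)
    _ ≤ 2 * ((frobNorm (M - M') * b) ^ 2 + (C * d) ^ 2) := add_sq_le
    _ = _ := by ring

/-- variance bound for the variance-reduced mini-batch estimator of
`[∇G(x)]ᵀ ∇g(G(x))` (Lemma `summandbound`). -/
theorem summand_variance_bound
    (N1 N2 n2 : ℕ) (hn2 : 0 < n2) (LG BG l b : ℝ)
    (G : Fin n2 → EuclideanSpace ℝ (Fin N2) → EuclideanSpace ℝ (Fin N1))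
    (DG : Fin n2 → EuclideanSpace ℝ (Fin N2) → Matrix (Fin N1) (Fin N2) ℝ)
    (hGd : ∀ j x, HasFDerivAt (G j) ((Matrix.toEuclideanLin (DG j x)).toContinuousLinearMap) x)
    (hGs : ∀ j x y, frobNorm (DG j x - DG j y) ≤ LG * ‖x - y‖)
    (hGb : ∀ j x, frobNorm (DG j x) ≤ BG)
    (g : EuclideanSpace ℝ (Fin N1) → ℝ) (hgd : Differentiable ℝ g)
    (hgs : ∀ p q, ‖gradient g p - gradient g q‖ ≤ l * ‖p - q‖)
    (hgb : ∀ y, ‖gradient g y‖ ≤ b)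
    (Gbar : EuclideanSpace ℝ (Fin N2) → EuclideanSpace ℝ (Fin N1))
    (hGbar : Gbar = fun x => (n2 : ℝ)⁻¹ • ∑ j, G j x)
    (DGbar : EuclideanSpace ℝ (Fin N2) → Matrix (Fin N1) (Fin N2) ℝ)
    (hDGbar : DGbar = fun x => (n2 : ℝ)⁻¹ • ∑ j, DG j x)
    (x xt : EuclideanSpace ℝ (Fin N2)) (A B : ℕ) (hA : 1 ≤ A) (hB : 1 ≤ B)
    (Ghat : (Fin A → Fin n2) → EuclideanSpace ℝ (Fin N1))
    (hGhat : ∀ σ, Ghat σ = ((A : ℝ)⁻¹ • ∑ t, (G (σ t) x - G (σ t) xt)) + Gbar xt)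
    (DGhat : (Fin B → Fin n2) → Matrix (Fin N1) (Fin N2) ℝ)
    (hDGhat : ∀ τ, DGhat τ = ((B : ℝ)⁻¹ • ∑ t, (DG (τ t) x - DG (τ t) xt)) + DGbar xt) :
    ((n2 : ℝ) ^ A)⁻¹ * ((n2 : ℝ) ^ B)⁻¹ *
        ∑ σ : Fin A → Fin n2, ∑ τ : Fin B → Fin n2,
          ‖Matrix.toEuclideanLin (DGhat τ)ᵀ (gradient g (Ghat σ))
            - Matrix.toEuclideanLin (DGbar x)ᵀ (gradient g (Gbar x))‖ ^ 2
      ≤ (2 * BG ^ 4 * l ^ 2 / A + 2 * b ^ 2 * LG ^ 2 / B) * ‖xt - x‖ ^ 2 := by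
  have hn : (0 : ℝ) < n2 := by exact_mod_cast hn2
  have frobNorm_DGbar : frobNorm (DGbar x) ≤ BG := by
    rw [← norm_euclideanVec, hDGbar, map_smul, map_sum, norm_smul,
      Real.norm_of_nonneg (by positivity), inv_mul_le_iff₀ hn]
    refine (norm_sum_le _ _).trans ?_
    simpa [norm_euclideanVec] using Finset.sum_le_sum fun j (_ : j ∈ Finset.univ) => hGb j x
  have variance_G : ((n2 : ℝ) ^ A)⁻¹ * ∑ σ, ‖Ghat σ - Gbar x‖ ^ 2
      ≤ BG ^ 2 * ‖xt - x‖ ^ 2 / A := by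
    have h := average_norm_sq_sample_mean_sub_le hn2 (fun j => G j x - G j xt) hA
      (c := BG ^ 2 * ‖xt - x‖ ^ 2) fun j => by
        rw [← mul_pow, norm_sub_rev xt]
        gcongr
        exact norm_sub_le_of_frobNorm_le (hGd j) (hGb j) x xt
    have error (σ : Fin A → Fin n2) : Ghat σ - Gbar x = (A : ℝ)⁻¹ • ∑ t, (G (σ t) x - G (σ t) xt)
        - (n2 : ℝ)⁻¹ • ∑ j, (G j x - G j xt) := by
      simp only [hGhat, hGbar, Finset.sum_sub_distrib, smul_sub]
      abel
    simpa only [error] using h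
  have variance_DG : ((n2 : ℝ) ^ B)⁻¹ * ∑ τ, frobNorm (DGhat τ - DGbar x) ^ 2
      ≤ LG ^ 2 * ‖xt - x‖ ^ 2 / B := by
    have h := average_norm_sq_sample_mean_sub_le hn2
      (fun j => euclideanVec _ _ (DG j x - DG j xt)) hB
      (c := LG ^ 2 * ‖xt - x‖ ^ 2) fun j => by
        rw [← mul_pow, norm_sub_rev xt, norm_euclideanVec]
        exact pow_le_pow_left₀ (frobNorm_nonneg _) (hGs j x xt) 2
    have error (τ : Fin B → Fin n2) : DGhat τ - DGbar x
        = (B : ℝ)⁻¹ • ∑ t, (DG (τ t) x - DG (τ t) xt)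
          - (n2 : ℝ)⁻¹ • ∑ j, (DG j x - DG j xt) := by
      simp only [hDGhat, hDGbar, Finset.sum_sub_distrib, smul_sub]
      abel
    simpa only [error, ← norm_euclideanVec, map_sub, map_smul, map_sum] using h
  have pointwise (σ : Fin A → Fin n2) (τ : Fin B → Fin n2) :=
    norm_sq_toEuclideanLin_transpose_sub_le (DGhat τ) (DGbar x) _ _ frobNorm_DGbar
      (hgb (Ghat σ)) (hgs (Ghat σ) (Gbar x))
  calc _ ≤ ((n2 : ℝ) ^ A)⁻¹ * ((n2 : ℝ) ^ B)⁻¹ * ∑ σ : Fin A → Fin n2, ∑ τ : Fin B → Fin n2,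
        (2 * b ^ 2 * frobNorm (DGhat τ - DGbar x) ^ 2
          + 2 * BG ^ 2 * (l * ‖Ghat σ - Gbar x‖) ^ 2) := by
        gcongr with σ _ τ _
        exact pointwise σ τ
    _ = 2 * b ^ 2 * (((n2 : ℝ) ^ B)⁻¹ * ∑ τ, frobNorm (DGhat τ - DGbar x) ^ 2)
        + 2 * BG ^ 2 * l ^ 2 * (((n2 : ℝ) ^ A)⁻¹ * ∑ σ, ‖Ghat σ - Gbar x‖ ^ 2) := by
        simp only [mul_pow, Finset.sum_add_distrib, ← Finset.mul_sum, Finset.sum_const,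
          Finset.card_univ, Fintype.card_pi, Fintype.card_fin, Finset.prod_const, nsmul_eq_mul,
          Nat.cast_pow]
        field_simp
    _ ≤ 2 * b ^ 2 * (LG ^ 2 * ‖xt - x‖ ^ 2 / B)
        + 2 * BG ^ 2 * l ^ 2 * (BG ^ 2 * ‖xt - x‖ ^ 2 / A) := by gcongr
    _ = _ := by ring
end

section
/- Let m ≥ 1 be an integer, θ > 1, τ₁ > 0, τ₂ ∈ ℝ, and let Ā, B̄, C̄ ≥ 0. Let d_0, d_1, …, d_m ≥ 0, R_0, R_1, …, R_m ≥ 0, and w, w' ≥ 0 be real numbers such that: (i) for each j = 0, 1, …, m−1, 0 ≤ ((1 − τ₁ − τ₂)/τ₁ + Ā) d_j − (1/τ₁) d_{j+1} + (τ₂/τ₁ + B̄) w + C̄ R_j − C̄ θ R_{j+1}; (ii) w' · Σ_{j=0}^{m−1} θ^j ≤ Σ_{j=0}^{m−1} θ^j d_{j+1}; and (iii) (τ₁ + τ₂ − 1 + 1/θ)/τ₁ − Ā ≥ 0. Then ((τ₁ + τ₂ − 1 + 1/θ)/τ₁ − Ā) θ w' Σ_{j=0}^{m−1} θ^j ≤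 ((1 − τ₁ − τ₂)/τ₁ + Ā)(d_0 − θ^m d_m) + (τ₂/τ₁ + B̄) w Σ_{j=0}^{m−1} θ^j + C̄ R_0 − C̄ θ^m R_m. -/
/-- Weighting a one-step recursion by `θ ^ j` and summing telescopes the `d j` and `R j` terms. -/
theorem geom_weighted_telescoping (a b c C θ : ℝ) (d R : ℕ → ℝ) (hθ : 0 ≤ θ) (m : ℕ)
    (h : ∀ j < m, 0 ≤ a * d j - c * d (j + 1) + b + C * R j - C * θ * R (j + 1)) :
    (c - a * θ) * ∑ j ∈ Finset.range m, θ ^ j * d (j + 1)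
      ≤ a * (d 0 - θ ^ m * d m) + b * ∑ j ∈ Finset.range m, θ ^ j
        + C * R 0 - C * θ ^ m * R m := by
  induction m with
  | zero => simp
  | succ n ih =>
    have hn := ih fun j hj => h j (hj.trans n.lt_succ_self)
    have hstep := mul_nonneg (pow_nonneg hθ n) (h n n.lt_succ_self)
    rw [Finset.sum_range_succ, Finset.sum_range_succ, pow_succ]
    linarith

/-- telescoping of the per-iteration inequality over one inner loop
(Lemma `telescoping`). -/
theorem inner_loop_telescoping
    (m : ℕ) (hm : 1 ≤ m) (θ τ₁ τ₂ Ab Bb Cb w w' : ℝ)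
    (hθ : 1 < θ) (hτ₁ : 0 < τ₁) (hAb : 0 ≤ Ab) (hBb : 0 ≤ Bb) (hCb : 0 ≤ Cb)
    (hw : 0 ≤ w) (hw' : 0 ≤ w')
    (d R : ℕ → ℝ) (hd : ∀ j ≤ m, 0 ≤ d j) (hR : ∀ j ≤ m, 0 ≤ R j)
    (h1 : ∀ j < m, 0 ≤ ((1 - τ₁ - τ₂) / τ₁ + Ab) * d j - 1 / τ₁ * d (j + 1)
      + (τ₂ / τ₁ + Bb) * w + Cb * R j - Cb * θ * R (j + 1))
    (h2 : w' * ∑ j ∈ Finset.range m, θ ^ j ≤ ∑ j ∈ Finset.range m, θ ^ j * d (j + 1))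
    (h3 : 0 ≤ (τ₁ + τ₂ - 1 + 1 / θ) / τ₁ - Ab) :
    ((τ₁ + τ₂ - 1 + 1 / θ) / τ₁ - Ab) * θ * w' * ∑ j ∈ Finset.range m, θ ^ j
      ≤ ((1 - τ₁ - τ₂) / τ₁ + Ab) * (d 0 - θ ^ m * d m)
        + (τ₂ / τ₁ + Bb) * w * ∑ j ∈ Finset.range m, θ ^ j
        + Cb * R 0 - Cb * θ ^ m * R m := by
  have hθ0 : 0 < θ := zero_lt_one.trans hθ
  have hcoef : ((τ₁ + τ₂ - 1 + 1 / θ) / τ₁ - Ab) * θ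
      = 1 / τ₁ - ((1 - τ₁ - τ₂) / τ₁ + Ab) * θ := by
    field_simp
    ring
  calc ((τ₁ + τ₂ - 1 + 1 / θ) / τ₁ - Ab) * θ * w' * ∑ j ∈ Finset.range m, θ ^ j
      = ((τ₁ + τ₂ - 1 + 1 / θ) / τ₁ - Ab) * θ * (w' * ∑ j ∈ Finset.range m, θ ^ j) :=
        mul_assoc _ _ _
    _ ≤ ((τ₁ + τ₂ - 1 + 1 / θ) / τ₁ - Ab) * θ * ∑ j ∈ Finset.range m, θ ^ j * d (j + 1) :=
        mul_le_mul_of_nonneg_left h2 (mul_nonneg h3 hθ0.le)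
    _ ≤ _ := by
        rw [hcoef]
        exact geom_weighted_telescoping _ _ _ _ _ d R hθ0.le m h1
end

section
/- Let m ≥ 1 be an integer, θ = 1 + 1/(12m), Ā ∈ (0, 1/8], B̄ ∈ (0, 1/8], τ₁ ∈ [1/(2m), 1), and 0 ≤ τ₂ ≤ τ₁. Then (τ₁ + τ₂ − 1 + 1/θ − Ā τ₁) θ / (τ₂ + B̄ τ₁) > 13/12. -/
/-- the elementary rate inequality (Lemma `usualrate`). -/
theorem usual_rate_inequality
    (m : ℕ) (hm : 1 ≤ m) (θ Ab Bb τ₁ τ₂ : ℝ)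
    (hθ : θ = 1 + 1 / (12 * m))
    (hAb : 0 < Ab) (hAb' : Ab ≤ 1 / 8) (hBb : 0 < Bb) (hBb' : Bb ≤ 1 / 8)
    (hτ₁ : 1 / (2 * m) ≤ τ₁) (hτ₁' : τ₁ < 1) (hτ₂ : 0 ≤ τ₂) (hτ₂' : τ₂ ≤ τ₁) :
    13 / 12 < (τ₁ + τ₂ - 1 + 1 / θ - Ab * τ₁) * θ / (τ₂ + Bb * τ₁) := by
  obtain ⟨e, he⟩ : ∃ e : ℝ, e = 1 / (12 * m) := ⟨_, rfl⟩
  have hm' : (1 : ℝ) ≤ m := by exact_mod_cast hm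
  have he0 : 0 < e := by rw [he]; positivity
  have he1 : e ≤ 1 / 12 := by
    rw [he]
    exact one_div_le_one_div_of_le (by norm_num) (by linarith)
  have hτe : 6 * e ≤ τ₁ := by
    refine le_trans (le_of_eq ?_) hτ₁
    rw [he]
    field_simp
    norm_num
  rw [← he] at hθ
  have hτ0 : 0 < τ₁ := by linarith
  have hθ0 : 0 < θ := by linarith
  have hden : 0 < τ₂ + Bb * τ₁ := by positivity
  rw [lt_div_iff₀ hden]
  have hnum : (τ₁ + τ₂ - 1 + 1 / θ - Ab * τ₁) * θ = (τ₁ + τ₂ - 1 - Ab * τ₁) * θ + 1 := by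
    field_simp
    ring
  rw [hnum]
  have hA : Ab * (τ₁ * θ) ≤ 1 / 8 * (τ₁ * θ) := by gcongr
  have hB : Bb * τ₁ ≤ 1 / 8 * τ₁ := by gcongr
  have hτ : (1 / 12 - e) * τ₂ ≤ (1 / 12 - e) * τ₁ :=
    mul_le_mul_of_nonneg_left hτ₂' (by linarith)
  have heτ : 0 < e * τ₁ := by positivity
  subst hθ
  linarith
end

section
/- Let m ≥ 1 be an integer, θ > 1, and let c_A, c_B, c_C, r ≥ 0 with c_B > 0, set T = Σ_{j=0}^{m−1} θ^j. Let d_0, d_m, R_0, R_m, w, w' ≥ 0 be real numbers. Assume: (i) r θ w' T ≤ c_A (d_0 − θ^m d_m) + c_B w T + c_C R_0 − c_C θ^m R_m; (ii) r θ ≥ (13/12) c_B; and (iii) θ^m ≥ 13/12. Then c_A d_m + c_B w' T + c_C R_m ≤ (12/13)(c_A d_0 + c_B w T + c_C R_0). -/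
/-- per-epoch geometric contraction with ratio 12/13. -/
theorem per_epoch_contraction
    (m : ℕ) (hm : 1 ≤ m) (θ cA cB cC r d0 dm R0 Rm w w' : ℝ)
    (hθ : 1 < θ) (hcA : 0 ≤ cA) (hcB : 0 < cB) (hcC : 0 ≤ cC) (hr : 0 ≤ r)
    (hd0 : 0 ≤ d0) (hdm : 0 ≤ dm) (hR0 : 0 ≤ R0) (hRm : 0 ≤ Rm)
    (hw : 0 ≤ w) (hw' : 0 ≤ w')
    (T : ℝ) (hT : T = ∑ j ∈ Finset.range m, θ ^ j)
    (h1 : r * θ * w' * T ≤ cA * (d0 - θ ^ m * dm) + cB * w * T + cC * R0 - cC * θ ^ m * Rm)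
    (h2 : r * θ ≥ 13 / 12 * cB)
    (h3 : θ ^ m ≥ 13 / 12) :
    cA * dm + cB * w' * T + cC * Rm ≤ 12 / 13 * (cA * d0 + cB * w * T + cC * R0) := by
  have hT0 : 0 ≤ T := by
    rw [hT]
    positivity
  have hwT := mul_le_mul_of_nonneg_right h2 (mul_nonneg hw' hT0)
  have hd := mul_le_mul_of_nonneg_right h3 (mul_nonneg hcA hdm)
  have hR := mul_le_mul_of_nonneg_right h3 (mul_nonneg hcC hRm)
  linarith
end

section
/- Let W₁, W₂ be finite-dimensional real inner product spaces, let g_1,…,g_n : W₁ → W₂ each be B-Lipschitz, and let ḡ = (1/n) Σ_{j=1}^n g_j. Then for any u, w ∈ W₁, any c ∈ W₂, and any integer a ≥ 1: n^{−a} Σ_{σ : {1,…,a} → {1,…,n}} ‖(1/a) Σ_{t=1}^{a} (g_{σ(t)}(u) − g_{σ(t)}(w)) + ḡ(w) − c‖² ≤ (B²/a)‖u − w‖² + ‖ḡ(u) − c‖². -/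
theorem sum_norm_add_sq_of_sum_eq_zero {ι E : Type*} [Fintype ι]
    [NormedAddCommGroup E] [InnerProductSpace ℝ E] (y : ι → E) (hy : ∑ j, y j = 0) (z : E) :
    ∑ j, ‖y j + z‖ ^ 2 = ∑ j, ‖y j‖ ^ 2 + Fintype.card ι * ‖z‖ ^ 2 := by
  simp only [norm_add_sq_real, Finset.sum_add_distrib, ← Finset.mul_sum, ← sum_inner, hy,
    inner_zero_left, mul_zero, add_zero, Finset.sum_const, Finset.card_univ, nsmul_eq_mul]

/-- Second moment of a shifted sum of `a` independent uniform samples from a centered family. -/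
theorem card_mul_sum_norm_sum_add_sq {ι E : Type*} [Fintype ι]
    [NormedAddCommGroup E] [InnerProductSpace ℝ E] (y : ι → E) (hy : ∑ j, y j = 0)
    (a : ℕ) (z : E) :
    (Fintype.card ι : ℝ) * ∑ σ : Fin a → ι, ‖∑ t, y (σ t) + z‖ ^ 2 =
      (Fintype.card ι : ℝ) ^ a *
        (Fintype.card ι * ‖z‖ ^ 2 + a * ∑ j, ‖y j‖ ^ 2) := by
  induction a generalizing z with
  | zero => simp
  | succ a ih =>
    have key : ∑ σ : Fin (a + 1) → ι, ‖∑ t, y (σ t) + z‖ ^ 2 =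
        ∑ j, ∑ σ : Fin a → ι, ‖∑ t, y (σ t) + (y j + z)‖ ^ 2 := by
      rw [← Fintype.sum_prod_type', ← (Fin.consEquiv fun _ => ι).sum_comp]
      refine Finset.sum_congr rfl fun p _ => ?_
      simp only [Fin.consEquiv_apply, Fin.sum_univ_succ, Fin.cons_zero, Fin.cons_succ]
      congr 2
      abel
    rw [key, Finset.mul_sum]
    simp only [ih]
    rw [← Finset.mul_sum, Finset.sum_add_distrib, ← Finset.mul_sum,
      sum_norm_add_sq_of_sum_eq_zero y hy, Finset.sum_const, Finset.card_univ, nsmul_eq_mul]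
    push_cast
    ring

/-- second-moment bound (around an arbitrary center `c`) for the mini-batch
variance-reduced estimator built from `B`-Lipschitz maps. -/
theorem minibatch_second_moment_bound
    {W₁ W₂ : Type*} [NormedAddCommGroup W₁] [InnerProductSpace ℝ W₁] [FiniteDimensional ℝ W₁]
    [NormedAddCommGroup W₂] [InnerProductSpace ℝ W₂] [FiniteDimensional ℝ W₂]
    (n : ℕ) (hn : 0 < n) (B : ℝ) (g : Fin n → W₁ → W₂)
    (hLip : ∀ j x y, ‖g j x - g j y‖ ≤ B * ‖x - y‖)
    (gb : W₁ → W₂) (hgb : gb = fun x => (n : ℝ)⁻¹ • ∑ j, g j x)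
    (u w : W₁) (c : W₂) (a : ℕ) (ha : 1 ≤ a) :
    ((n : ℝ) ^ a)⁻¹ * ∑ σ : Fin a → Fin n,
        ‖((a : ℝ)⁻¹ • ∑ t, (g (σ t) u - g (σ t) w)) + gb w - c‖ ^ 2
      ≤ B ^ 2 / a * ‖u - w‖ ^ 2 + ‖gb u - c‖ ^ 2 := by
  have hn0 : (n : ℝ) ≠ 0 := by positivity
  have ha0 : (0 : ℝ) < a := by exact_mod_cast ha
  set m : W₂ := gb u - gb w with hm
  let y : Fin n → W₂ := fun j => (g j u - g j w) - m
  have hnm : (n : ℝ) • m = ∑ j, (g j u - g j w) := by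
    rw [hm, hgb, ← smul_sub, smul_inv_smul₀ hn0, Finset.sum_sub_distrib]
  have hy : ∑ j, y j = 0 := by
    simp only [y]
    rw [Finset.sum_sub_distrib, ← hnm, Finset.sum_const, Finset.card_univ, Fintype.card_fin,
      ← Nat.cast_smul_eq_nsmul ℝ, sub_self]
  have hS : ∑ j, ‖y j‖ ^ 2 ≤ n * (B ^ 2 * ‖u - w‖ ^ 2) := by
    have h1 := sum_norm_add_sq_of_sum_eq_zero y hy m
    have h2 : ∑ j, ‖y j + m‖ ^ 2 ≤ ∑ _j : Fin n, B ^ 2 * ‖u - w‖ ^ 2 := by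
      refine Finset.sum_le_sum fun j _ => ?_
      simp only [y, sub_add_cancel]
      rw [← mul_pow]
      exact pow_le_pow_left₀ (norm_nonneg _) (hLip j u w) 2
    simp only [Finset.sum_const, Finset.card_univ, Fintype.card_fin, nsmul_eq_mul] at h1 h2
    nlinarith [mul_nonneg (Nat.cast_nonneg (α := ℝ) n) (sq_nonneg ‖m‖)]
  have hest : ∀ σ : Fin a → Fin n,
      ‖((a : ℝ)⁻¹ • ∑ t, (g (σ t) u - g (σ t) w)) + gb w - c‖ ^ 2 =
        ((a : ℝ)⁻¹) ^ 2 * ‖∑ t, y (σ t) + (a : ℝ) • (gb u - c)‖ ^ 2 := by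
    intro σ
    have : ((a : ℝ)⁻¹ • ∑ t, (g (σ t) u - g (σ t) w)) + gb w - c =
        (a : ℝ)⁻¹ • (∑ t, y (σ t) + (a : ℝ) • (gb u - c)) := by
      simp only [y]
      rw [Finset.sum_sub_distrib _ fun _ => m, Finset.sum_const, Finset.card_univ, Fintype.card_fin,
        ← Nat.cast_smul_eq_nsmul ℝ, smul_add, smul_sub, inv_smul_smul₀ ha0.ne',
        inv_smul_smul₀ ha0.ne', hm]
      abel
    rw [this, norm_smul, mul_pow, Real.norm_eq_abs, sq_abs]
  simp only [hest]
  rw [← Finset.mul_sum]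
  have hsum := card_mul_sum_norm_sum_add_sq y hy a ((a : ℝ) • (gb u - c))
  rw [Fintype.card_fin, norm_smul, mul_pow, Real.norm_eq_abs, sq_abs] at hsum
  rw [eq_div_of_mul_eq hn0 ((mul_comm _ _).trans hsum)]
  calc _ = (∑ j, ‖y j‖ ^ 2) / (a * n) + ‖gb u - c‖ ^ 2 := by
        field_simp
        ring
    _ ≤ n * (B ^ 2 * ‖u - w‖ ^ 2) / (a * n) + ‖gb u - c‖ ^ 2 := by gcongr
    _ = _ := by field_simp
end
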